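/- Let G be the Higman–Sims graph constructed from a Steiner system S(3,6,22). Then N(G,3) ≥ 3^77; that is, there exists a guessing strategy for the guessing game on G with alphabet of size 3 for which at least 3^77 assignments are winning, so gn(G,3) ≥ 77. -/

import Mathlib

/-- A guessing strategy on graph `G` with alphabet `A`: each player `v` maps the
values of its neighbours to a guess of its own value. -/
def GuessStrategy {V : Type*} (G : SimpleGraph V) (A : Type*) : Type _ :=
  ∀ v : V, ((G.neighborSet v) → A) → A

/-- An assignment `a : V → A` is winning for the strategy `F` if every player
guesses its own value correctly. -/
def WinningAssignment {V : Type*} {G : SimpleGraph V} {A : Type*}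
    (F : GuessStrategy G A) (a : V → A) : Prop :=
  ∀ v : V, F v (fun u => a u.1) = a v

/-- The number of assignments won by strategy `F` in the game `(G, s)`. -/
noncomputable def winCount {V : Type*} (G : SimpleGraph V) (s : ℕ)
    (F : GuessStrategy G (Fin s)) : ℕ :=
  Nat.card {a : V → Fin s // WinningAssignment F a}

/-- `N(G,s)`: the maximum number of winning assignments over all strategies. -/
noncomputable def maxWinCount {V : Type*} (G : SimpleGraph V) (s : ℕ) : ℕ :=
  sSup {n | ∃ F : GuessStrategy G (Fin s), winCount G s F = n}

/-- The guessing number `gn(G,s) = log_s N(G,s)`. -/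
noncomputable def gn {V : Type*} (G : SimpleGraph V) (s : ℕ) : ℝ :=
  Real.logb s (maxWinCount G s)

/-- The `t`-uniform blowup of `G`. -/
def blowup {V : Type*} (G : SimpleGraph V) (t : ℕ) : SimpleGraph (V × Fin t) :=
  G.comap Prod.fst

/-- Vertex set of the Higman–Sims graph built from a Steiner system S(3,6,22):
a distinguished vertex `∞` (i.e. `none`), the 22 points, and the 77 blocks. -/
abbrev HSVertex (P : Type*) (B : Finset (Finset P)) : Type _ :=
  Option (P ⊕ {b : Finset P // b ∈ B})

/-- The Higman–Sims graph built from a Steiner system S(3,6,22): `∞` is joined to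
every point, a point is joined to the blocks containing it, and two distinct blocks
are joined exactly when they are disjoint. -/
def higmanSims (P : Type*) [DecidableEq P] (B : Finset (Finset P)) :
    SimpleGraph (HSVertex P B) :=
  SimpleGraph.fromRel (fun x y =>
    match x, y with
    | none, some (Sum.inl _) => True
    | some (Sum.inl p), some (Sum.inr b) => p ∈ b.1
    | some (Sum.inr b), some (Sum.inr c) => b.1 ∩ c.1 = ∅
    | _, _ => False)

open Finset

section Steiner

variable {P : Type*} [DecidableEq P] {B : Finset (Finset P)}

theorem steiner_eq_of_mem
    (hsteiner : ∀ t : Finset P, t.card = 3 → ∃! b, b ∈ B ∧ t ⊆ b)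
    {b c : Finset P} (hb : b ∈ B) (hc : c ∈ B) {x y z : P}
    (hxy : x ≠ y) (hxz : x ≠ z) (hyz : y ≠ z)
    (hxb : x ∈ b) (hyb : y ∈ b) (hzb : z ∈ b)
    (hxc : x ∈ c) (hyc : y ∈ c) (hzc : z ∈ c) : b = c := by
  refine (hsteiner {x, y, z} (card_eq_three.2 ⟨x, y, z, hxy, hxz, hyz, rfl⟩)).unique
    ⟨hb, ?_⟩ ⟨hc, ?_⟩ <;> simp [insert_subset_iff, *]

variable [Fintype P]

theorem steiner_card_blocks (hP : Fintype.card P = 22) (hsize : ∀ b ∈ B, b.card = 6)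
    (hsteiner : ∀ t : Finset P, t.card = 3 → ∃! b, b ∈ B ∧ t ⊆ b) : B.card = 77 := by
  have h := sum_card_bipartiteAbove_eq_sum_card_bipartiteBelow
    (s := powersetCard 3 (univ : Finset P)) (t := B) (fun t b => t ⊆ b)
  have h₁ : ∀ t ∈ powersetCard 3 (univ : Finset P),
      (bipartiteAbove (fun t b => t ⊆ b) B t).card = 1 := by
    intro t ht
    obtain ⟨b, hb, hu⟩ := hsteiner t (mem_powersetCard.1 ht).2
    refine card_eq_one.2 ⟨b, ext fun c => ?_⟩
    rw [mem_bipartiteAbove, mem_singleton]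
    exact ⟨hu c, fun h => h ▸ hb⟩
  have h₂ : ∀ b ∈ B,
      (bipartiteBelow (fun t b => t ⊆ b) (powersetCard 3 (univ : Finset P)) b).card = 20 := by
    intro b hb
    have : bipartiteBelow (fun t b => t ⊆ b) (powersetCard 3 (univ : Finset P)) b
        = powersetCard 3 b := by
      ext t
      simp [mem_bipartiteBelow, mem_powersetCard, and_comm]
    rw [this, card_powersetCard, hsize b hb]
    rfl
  rw [sum_congr rfl h₁, sum_congr rfl h₂] at h
  simp only [sum_const, card_powersetCard, card_univ, hP, smul_eq_mul] at h
  have : Nat.choose 22 3 = 1540 := by decide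
  omega

theorem steiner_card_blocks_through_pair (hP : Fintype.card P = 22)
    (hsize : ∀ b ∈ B, b.card = 6)
    (hsteiner : ∀ t : Finset P, t.card = 3 → ∃! b, b ∈ B ∧ t ⊆ b)
    {p q : P} (hpq : p ≠ q) : (B.filter fun b => p ∈ b ∧ q ∈ b).card = 5 := by
  have h := sum_card_bipartiteAbove_eq_sum_card_bipartiteBelow
    (s := (univ : Finset P) \ {p, q}) (t := B.filter fun b => p ∈ b ∧ q ∈ b)
    (fun x b => x ∈ b)
  have h₁ : ∀ x ∈ (univ : Finset P) \ {p, q},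
      (bipartiteAbove (fun x b => x ∈ b) (B.filter fun b => p ∈ b ∧ q ∈ b) x).card = 1 := by
    intro x hx
    have hx' : x ≠ p ∧ x ≠ q := by simpa using hx
    obtain ⟨b, hb, hu⟩ := hsteiner {p, q, x}
      (card_eq_three.2 ⟨p, q, x, hpq, hx'.1.symm, hx'.2.symm, rfl⟩)
    simp only [insert_subset_iff, singleton_subset_iff] at hb hu
    refine card_eq_one.2 ⟨b, ext fun c => ?_⟩
    simp only [mem_bipartiteAbove, mem_singleton, mem_filter]
    refine ⟨fun h => hu c ⟨h.1.1, h.1.2.1, h.1.2.2, h.2⟩, fun h => ?_⟩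
    subst h
    exact ⟨⟨hb.1, hb.2.1, hb.2.2.1⟩, hb.2.2.2⟩
  have h₂ : ∀ b ∈ B.filter fun b => p ∈ b ∧ q ∈ b,
      (bipartiteBelow (fun x b => x ∈ b) ((univ : Finset P) \ {p, q}) b).card = 4 := by
    intro b hb
    obtain ⟨hb, hp, hq⟩ := mem_filter.1 hb
    have : bipartiteBelow (fun x b => x ∈ b) ((univ : Finset P) \ {p, q}) b = b \ {p, q} := by
      ext t
      simp [mem_bipartiteBelow, and_comm]
    rw [this, card_sdiff_of_subset (by simp [insert_subset_iff, hp, hq]), hsize b hb,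
      card_pair hpq]
  rw [sum_congr rfl h₁, sum_congr rfl h₂] at h
  simp only [sum_const, smul_eq_mul] at h
  rw [card_sdiff_of_subset (subset_univ _), card_pair hpq, card_univ, hP] at h
  omega

/-- Two distinct blocks of an `S(3,6,22)` meet in `0` or `2` points. -/
theorem steiner_card_inter (hP : Fintype.card P = 22) (hsize : ∀ b ∈ B, b.card = 6)
    (hsteiner : ∀ t : Finset P, t.card = 3 → ∃! b, b ∈ B ∧ t ⊆ b)
    {b c : Finset P} (hb : b ∈ B) (hc : c ∈ B) (hbc : b ≠ c) (hne : b ∩ c ≠ ∅) :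
    (b ∩ c).card = 2 := by
  have hle : (b ∩ c).card ≤ 2 := by
    by_contra! h
    obtain ⟨x, y, z, hx, hy, hz, hxy, hxz, hyz⟩ := two_lt_card_iff.1 h
    simp only [mem_inter] at hx hy hz
    exact hbc (steiner_eq_of_mem hsteiner hb hc hxy hxz hyz hx.1 hy.1 hz.1 hx.2 hy.2 hz.2)
  obtain ⟨p, hp⟩ := nonempty_iff_ne_empty.2 hne
  have hpb := (mem_inter.1 hp).1
  have hpc := (mem_inter.1 hp).2
  obtain ⟨q, hqc, hqb⟩ : ∃ q ∈ c, q ∉ b := by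
    by_contra! h
    exact hbc (eq_of_subset_of_card_le h (by rw [hsize b hb, hsize c hc])).symm
  have hpq : p ≠ q := fun h => hqb (h ▸ hpb)
  have hex : ∀ r ∈ b.erase p, ∃ d ∈ B.filter (fun d => p ∈ d ∧ q ∈ d), r ∈ d := by
    intro r hr
    obtain ⟨hrp, hrb⟩ := mem_erase.1 hr
    have hrq : q ≠ r := fun h => hqb (h ▸ hrb)
    obtain ⟨d, ⟨hd, hs⟩, -⟩ := hsteiner {p, q, r}
      (card_eq_three.2 ⟨p, q, r, hpq, hrp.symm, hrq, rfl⟩)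
    simp only [insert_subset_iff, singleton_subset_iff] at hs
    exact ⟨d, mem_filter.2 ⟨hd, hs.1, hs.2.1⟩, hs.2.2⟩
  choose! f hf hrf using hex
  have hinj : Set.InjOn f (b.erase p) := by
    intro r hr s hs hrs
    by_contra hne'
    have hr' := mem_erase.1 (mem_coe.1 hr)
    have hs' := mem_erase.1 (mem_coe.1 hs)
    have hd := mem_filter.1 (hf r hr)
    refine hqb ?_
    rw [steiner_eq_of_mem hsteiner hb hd.1 (Ne.symm hr'.1) (Ne.symm hs'.1) hne' hpb hr'.2 hs'.2
      hd.2.1 (hrf r hr) (hrs ▸ hrf s hs)]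
    exact hd.2.2
  have hsurj := surjOn_of_injOn_of_card_le f (fun r hr => hf r hr) hinj (by
    rw [steiner_card_blocks_through_pair hP hsize hsteiner hpq, card_erase_of_mem hpb, hsize b hb])
  obtain ⟨r, hr, hrc⟩ := hsurj (mem_coe.2 (mem_filter.2 ⟨hc, hpc, hqc⟩))
  have hr' := mem_erase.1 (mem_coe.1 hr)
  have hrmem : r ∈ b ∩ c := mem_inter.2 ⟨hr'.2, hrc ▸ hrf r hr⟩
  exact le_antisymm hle (one_lt_card.2 ⟨p, hp, r, hrmem, hr'.1.symm⟩)

end Steiner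

section Adjacency

variable {P : Type*} [DecidableEq P] {B : Finset (Finset P)}

theorem higmanSims_adj_none_none : ¬ (higmanSims P B).Adj none none :=
  (higmanSims P B).irrefl

theorem higmanSims_adj_none_point (p : P) :
    (higmanSims P B).Adj none (some (Sum.inl p)) := by
  simp [higmanSims]

theorem higmanSims_adj_none_block (b : {b // b ∈ B}) :
    ¬ (higmanSims P B).Adj none (some (Sum.inr b)) := by
  simp [higmanSims]

theorem higmanSims_adj_point_point (p q : P) :
    ¬ (higmanSims P B).Adj (some (Sum.inl p)) (some (Sum.inl q)) := by
  simp [higmanSims]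

theorem higmanSims_adj_point_block (p : P) (b : {b // b ∈ B}) :
    (higmanSims P B).Adj (some (Sum.inl p)) (some (Sum.inr b)) ↔ p ∈ b.1 := by
  simp [higmanSims]

theorem higmanSims_adj_block_block (b c : {b // b ∈ B}) :
    (higmanSims P B).Adj (some (Sum.inr b)) (some (Sum.inr c)) ↔ b ≠ c ∧ b.1 ∩ c.1 = ∅ := by
  simp [higmanSims, inter_comm c.1 b.1]

end Adjacency

open Classical in
/-- The linear strategy in which every player guesses minus the sum of the values it sees. -/
noncomputable def negSumStrategy {V : Type*} [Fintype V] (G : SimpleGraph V) :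
    GuessStrategy G (ZMod 3) :=
  fun _ x => -∑ u, x u

open Classical in
theorem winning_negSumStrategy_iff {V : Type*} [Fintype V] (G : SimpleGraph V)
    (a : V → ZMod 3) :
    WinningAssignment (negSumStrategy G) a ↔
      ∀ v, a v + ∑ u, (if G.Adj v u then a u else 0) = 0 := by
  refine forall_congr' fun v => ?_
  have : ∑ u : G.neighborSet v, a u = ∑ u, (if G.Adj v u then a u else 0) := by
    rw [← sum_filter]
    exact (sum_subtype _ (by simp) _).symm
  rw [negSumStrategy, this, neg_eq_iff_add_eq_zero, add_comm]

section Kernel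

variable {P : Type*} [Fintype P] [DecidableEq P]

/-- The `23` linear equations over `ZMod 3` that imply all equations of the negative-sum strategy:
those at the points, and the vanishing of the sum over all blocks. -/
def higmanSimsChecks (B : Finset (Finset P)) :
    (HSVertex P B → ZMod 3) →ₗ[ZMod 3] (Option P → ZMod 3) where
  toFun a := fun o => match o with
    | none => ∑ b, a (some (Sum.inr b))
    | some p => a none + a (some (Sum.inl p)) + ∑ b, if p ∈ b.1 then a (some (Sum.inr b)) else 0
  map_add' a a' := by
    funext o
    cases o
    · simp [sum_add_distrib]
    · simp only [Pi.add_apply, ite_add_zero, sum_add_distrib]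
      ring
  map_smul' r a := by
    funext o
    cases o
    · simp [mul_sum]
    · simp [mul_sum, mul_add]

theorem card_ker_higmanSimsChecks (hP : Fintype.card P = 22) {B : Finset (Finset P)}
    (hB : B.card = 77) :
    3 ^ 77 ≤ Nat.card (LinearMap.ker (higmanSimsChecks B)) := by
  have h := (higmanSimsChecks B).finrank_range_add_finrank_ker
  have h' := (LinearMap.range (higmanSimsChecks B)).finrank_le
  simp only [Module.finrank_fintype_fun_eq_card, Fintype.card_option, Fintype.card_sum,
    Fintype.card_coe, hP, hB] at h h'
  rw [Module.natCard_eq_pow_finrank (K := ZMod 3), Nat.card_zmod]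
  exact Nat.pow_le_pow_right (by norm_num) (by omega)

open Classical in
theorem winning_of_mem_ker (hP : Fintype.card P = 22) {B : Finset (Finset P)}
    (hsize : ∀ b ∈ B, b.card = 6)
    (hsteiner : ∀ t : Finset P, t.card = 3 → ∃! b, b ∈ B ∧ t ⊆ b)
    {a : HSVertex P B → ZMod 3} (ha : a ∈ LinearMap.ker (higmanSimsChecks B)) :
    WinningAssignment (negSumStrategy (higmanSims P B)) a := by
  have hsum : ∑ b, a (some (Sum.inr b)) = 0 := congrFun (LinearMap.mem_ker.1 ha) none
  have hpt (p : P) : a none + a (some (Sum.inl p)) +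
      ∑ b : {b // b ∈ B}, (if p ∈ b.1 then a (some (Sum.inr b)) else 0) = 0 :=
    congrFun (LinearMap.mem_ker.1 ha) (some p)
  have hpt' (p : P) : a (some (Sum.inl p)) = -a none -
      ∑ b : {b // b ∈ B}, (if p ∈ b.1 then a (some (Sum.inr b)) else 0) := by
    linear_combination hpt p
  have h3 : (3 : ZMod 3) = 0 := by decide
  have hover (s : Finset P) : ∑ p ∈ s, a (some (Sum.inl p)) =
      -(s.card * a none) - ∑ b : {b // b ∈ B}, ((s ∩ b.1).card : ZMod 3) * a (some (Sum.inr b)) := by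
    simp only [hpt', sum_sub_distrib, sum_const, nsmul_eq_mul, mul_neg]
    rw [sum_comm]
    congr 1
    refine sum_congr rfl fun b _ => ?_
    rw [← sum_filter, sum_const, nsmul_eq_mul, filter_mem_eq_inter]
  rw [winning_negSumStrategy_iff]
  rintro (_ | p | b) <;> rw [Fintype.sum_option, Fintype.sum_sum_type]
  · simp only [higmanSims_adj_none_none, higmanSims_adj_none_point, higmanSims_adj_none_block,
      if_true, if_false, sum_const_zero, hover, univ_inter, card_univ, hP]
    have h6 : ∀ b : {b // b ∈ B}, ((b.1.card : ℕ) : ZMod 3) * a (some (Sum.inr b)) = 0 := by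
      intro b
      rw [hsize b b.2]
      push_cast
      linear_combination 2 * a (some (Sum.inr b)) * h3
    simp only [h6, sum_const_zero]
    push_cast
    linear_combination -7 * a none * h3
  · simp only [(higmanSims P B).adj_comm (some (Sum.inl p)) none, higmanSims_adj_none_point,
      higmanSims_adj_point_point, higmanSims_adj_point_block, if_true, if_false, sum_const_zero]
    linear_combination hpt p
  · have hbn : ¬ (higmanSims P B).Adj (some (Sum.inr b)) none :=
      fun h => higmanSims_adj_none_block b h.symm
    have hbp (p : P) : (higmanSims P B).Adj (some (Sum.inr b)) (some (Sum.inl p)) ↔ p ∈ b.1 := by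
      rw [SimpleGraph.adj_comm, higmanSims_adj_point_block]
    simp only [hbn, hbp, higmanSims_adj_block_block, if_false]
    rw [← sum_filter, filter_mem_eq_inter, univ_inter, hover, hsize b b.2]
    have hself : a (some (Sum.inr b)) =
        ∑ c : {c // c ∈ B}, if b = c then a (some (Sum.inr c)) else 0 := by simp
    have key (c : {c // c ∈ B}) : (if b = c then a (some (Sum.inr c)) else 0)
        - ((b.1 ∩ c.1).card : ZMod 3) * a (some (Sum.inr c))
        + (if b ≠ c ∧ b.1 ∩ c.1 = ∅ then a (some (Sum.inr c)) else 0)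
        = a (some (Sum.inr c)) := by
      by_cases hbc : b = c
      · subst hbc
        simp only [inter_self, hsize b b.2, if_true, ne_eq, not_true_eq_false, false_and, if_false]
        push_cast
        linear_combination -2 * a (some (Sum.inr b)) * h3
      · by_cases he : b.1 ∩ c.1 = ∅
        · simp [hbc, he]
        · rw [steiner_card_inter hP hsize hsteiner b.2 c.2 (fun h => hbc (Subtype.ext h)) he]
          simp only [hbc, he, if_false, and_false]
          push_cast
          linear_combination -a (some (Sum.inr c)) * h3
    have hk := sum_congr (rfl : (univ : Finset {c // c ∈ B}) = univ) fun c _ => key c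
    rw [sum_add_distrib, sum_sub_distrib, ← hself, hsum] at hk
    push_cast
    linear_combination hk - 2 * a none * h3

end Kernel

theorem winCount_le_maxWinCount {V : Type*} [Fintype V] (G : SimpleGraph V) (s : ℕ)
    (F : GuessStrategy G (Fin s)) : winCount G s F ≤ maxWinCount G s := by
  refine le_csSup ⟨Nat.card (V → Fin s), ?_⟩ ⟨F, rfl⟩
  rintro _ ⟨F, rfl⟩
  exact Finite.card_subtype_le _

/-- For the Higman–Sims graph G, N(G,3) ≥ 3^77: there is a guessing
strategy over an alphabet of size 3 winning at least 3^77 assignments, and hence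
gn(G,3) ≥ 77. -/
theorem higmanSims_guessing_number_ge {P : Type*} [Fintype P] [DecidableEq P]
    (hP : Fintype.card P = 22) (B : Finset (Finset P))
    (hsize : ∀ b ∈ B, b.card = 6)
    (hsteiner : ∀ t : Finset P, t.card = 3 → ∃! b, b ∈ B ∧ t ⊆ b) :
    (∃ F : GuessStrategy (higmanSims P B) (Fin 3), 3 ^ 77 ≤ winCount (higmanSims P B) 3 F) ∧
      3 ^ 77 ≤ maxWinCount (higmanSims P B) 3 ∧
      (77 : ℝ) ≤ gn (higmanSims P B) 3 := by
  have hB := steiner_card_blocks hP hsize hsteiner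
  have hF : 3 ^ 77 ≤ winCount (higmanSims P B) 3 (negSumStrategy (higmanSims P B)) := by
    refine (card_ker_higmanSimsChecks hP hB).trans ?_
    exact Nat.card_le_card_of_injective
      (fun a => (⟨a.1, winning_of_mem_ker hP hsize hsteiner a.2⟩ :
        {a : HSVertex P B → Fin 3 //
          WinningAssignment (A := Fin 3) (negSumStrategy (higmanSims P B)) a}))
      (fun a a' h => Subtype.ext (Subtype.mk.inj h))
  have hmax := hF.trans (winCount_le_maxWinCount _ _ _)
  refine ⟨⟨_, hF⟩, hmax, ?_⟩
  rw [gn, Real.le_logb_iff_rpow_le (by norm_num)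
    (by exact_mod_cast lt_of_lt_of_le (by positivity) hmax)]
  exact_mod_cast hmax
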